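/- (Lewis–Stegall) Let E be a Banach space and let T : L₁[0,1] → E be a bounded operator. Then T is representable if and only if T factors boundedly through ℓ₁; that is, if and only if there exist bounded operators R : L₁[0,1] → ℓ₁ and S : ℓ₁ → E with T = S ∘ R. -/

import Mathlib

open scoped TensorProduct ENNReal
open MeasureTheory Filter

noncomputable section

/-- Lebesgue measure on `ℝ` restricted to the unit interval `[0,1]`. -/
def μ01 : Measure ℝ := volume.restrict (Set.Icc 0 1)

/-- The complex Lebesgue space `L₁[0,1]`. -/
abbrev L1C : Type := Lp ℂ 1 μ01

/-- An operator `T : L₁[0,1] → E` is representable if there is a bounded, strongly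
measurable `h : [0,1] → E` such that `T f = ∫₀¹ f(s) • h(s) ds` (a Bochner integral). -/
def IsRepresentable {E : Type*} [NormedAddCommGroup E] [NormedSpace ℂ E]
    (T : L1C →L[ℂ] E) : Prop :=
  ∃ h : ℝ → E, StronglyMeasurable h ∧ (∃ C : ℝ, ∀ t ∈ Set.Icc (0:ℝ) 1, ‖h t‖ ≤ C) ∧
    ∀ f : L1C, T f = ∫ s, (f : ℝ → ℂ) s • h s ∂μ01

/-- The space `ℓ₁` of absolutely summable complex sequences. -/
abbrev ell1 : Type := lp (fun _ : ℕ => ℂ) 1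

section Representation

variable {α : Type*} [MeasurableSpace α] {μ : Measure α}
  {F : Type*} [NormedAddCommGroup F] [NormedSpace ℂ F]

/-- A function on a measurable space with values in `ℓ₁` is strongly measurable as soon as its
coordinates are. -/
lemma stronglyMeasurable_ell1 {a : α → ell1} (ha : ∀ n, StronglyMeasurable fun t => a t n) :
    StronglyMeasurable a := by
  refine stronglyMeasurable_of_tendsto (u := (atTop : Filter ℕ))
    (f := fun N t => ∑ n ∈ Finset.range N, lp.single 1 n (a t n)) (fun N => ?_) ?_
  · refine Finset.stronglyMeasurable_fun_sum _ fun n _ => ?_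
    exact (lp.singleContinuousLinearMap ℂ (fun _ : ℕ => ℂ) 1 n).continuous.comp_stronglyMeasurable
      (ha n)
  · rw [tendsto_pi_nhds]
    exact fun t => (lp.hasSum_single ENNReal.one_ne_top (a t)).tendsto_sum_nat

/-- Bounded operators on `L₁` which agree on indicator functions coincide. -/
lemma clm_ext_indicatorConstLp [IsFiniteMeasure μ] {S T : Lp ℂ 1 μ →L[ℂ] F}
    (h : ∀ s (hs : MeasurableSet s), S (indicatorConstLp 1 hs (measure_ne_top μ s) 1) =
      T (indicatorConstLp 1 hs (measure_ne_top μ s) 1)) : S = T := by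
  ext f
  refine Lp.induction ENNReal.one_ne_top (fun f => S f = T f) ?_ ?_ ?_ f
  · intro c s hs hμs
    have hc : (Lp.simpleFunc.indicatorConst 1 hs hμs.ne c : Lp ℂ 1 μ) =
        c • indicatorConstLp 1 hs (measure_ne_top μ s) 1 := by
      rw [Lp.simpleFunc.coe_indicatorConst, indicatorConstLp, indicatorConstLp,
        ← MemLp.toLp_const_smul]
      refine MemLp.toLp_congr _ _ (Eventually.of_forall fun t => ?_)
      by_cases ht : t ∈ s <;> simp [ht]
    rw [hc, map_smul, map_smul, h s hs]
  · intro f g hf hg _ h1 h2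
    rw [map_add, map_add, h1, h2]
  · exact isClosed_eq S.continuous T.continuous

/-- Integration against a bounded strongly measurable function, as an operator on `L₁`. -/
lemma exists_clm_integral_smul {a : α → F} (ha : AEStronglyMeasurable a μ) {C : ℝ}
    (hC : ∀ᵐ t ∂μ, ‖a t‖ ≤ C) :
    ∃ T : Lp ℂ 1 μ →L[ℂ] F, ∀ f : Lp ℂ 1 μ, T f = ∫ t, (f : α → ℂ) t • a t ∂μ := by
  have hint (f : Lp ℂ 1 μ) : Integrable (fun t => (f : α → ℂ) t • a t) μ :=
    (L1.integrable_coeFn f).smul_bdd C ha hC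
  refine ⟨LinearMap.mkContinuous
    { toFun := fun f => ∫ t, (f : α → ℂ) t • a t ∂μ
      map_add' := fun f g => ?_
      map_smul' := fun c f => ?_ } C fun f => ?_, fun f => rfl⟩
  · rw [← integral_add (hint f) (hint g)]
    refine integral_congr_ae ?_
    filter_upwards [Lp.coeFn_add f g] with t ht
    rw [ht, Pi.add_apply, add_smul]
  · rw [RingHom.id_apply, ← integral_smul]
    refine integral_congr_ae ?_
    filter_upwards [Lp.coeFn_smul c f] with t ht
    rw [ht, Pi.smul_apply, smul_assoc]
  · rw [L1.norm_eq_integral_norm, ← integral_const_mul]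
    refine norm_integral_le_of_norm_le ((L1.integrable_coeFn f).norm.const_mul C) ?_
    filter_upwards [hC] with t ht
    rw [norm_smul, mul_comm]
    gcongr

/-- A bounded functional on `L₁` of a probability measure is, on indicator functions, integration
against an integrable density. -/
lemma exists_density_of_functional [IsProbabilityMeasure μ] (l : Lp ℂ 1 μ →L[ℂ] ℂ) :
    ∃ g : α → ℂ, StronglyMeasurable g ∧ Integrable g μ ∧ ∀ s (hs : MeasurableSet s),
      l (indicatorConstLp 1 hs (measure_ne_top μ s) 1) = ∫ t in s, g t ∂μ := by
  have hle : (1 : ℝ≥0∞) ≤ 2 := by norm_num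
  let J : Lp ℂ 2 μ →L[ℂ] Lp ℂ 1 μ := LinearMap.mkContinuous
    { toFun := fun f => ((Lp.memLp f).mono_exponent hle).toLp f
      map_add' := fun f g => by
        rw [← MemLp.toLp_add]
        exact MemLp.toLp_congr _ _ (Lp.coeFn_add f g)
      map_smul' := fun c f => by
        rw [RingHom.id_apply, ← MemLp.toLp_const_smul]
        exact MemLp.toLp_congr _ _ (Lp.coeFn_smul c f) } 1 fun f => by
      rw [one_mul]
      change ‖((Lp.memLp f).mono_exponent hle).toLp f‖ ≤ ‖f‖
      rw [Lp.norm_toLp, Lp.norm_def]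
      exact ENNReal.toReal_mono (Lp.memLp f).2.ne
        (eLpNorm_le_eLpNorm_of_exponent_le hle (Lp.aestronglyMeasurable f))
  have hJ (s : Set α) (hs : MeasurableSet s) :
      J (indicatorConstLp 2 hs (measure_ne_top μ s) 1) =
        indicatorConstLp 1 hs (measure_ne_top μ s) 1 :=
    MemLp.toLp_congr ((Lp.memLp _).mono_exponent hle) _ indicatorConstLp_coeFn
  let y : Lp ℂ 2 μ := (InnerProductSpace.toDual ℂ (Lp ℂ 2 μ)).symm (l.comp J)
  have hy : Integrable (y : α → ℂ) μ := (Lp.memLp y).integrable hle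
  refine ⟨fun t => star ((y : α → ℂ) t), (Lp.stronglyMeasurable y).star, ?_, fun s hs => ?_⟩
  · exact (ContinuousLinearEquiv.integrable_comp_iff
      (Complex.conjCLE : ℂ ≃L[ℝ] ℂ)).2 hy
  · rw [← hJ s hs, ← ContinuousLinearMap.comp_apply,
      ← InnerProductSpace.toDual_symm_apply (x := indicatorConstLp 2 hs _ _)]
    rw [← inner_conj_symm, L2.inner_indicatorConstLp_one hs (measure_ne_top μ s) y,
      ← integral_conj]
    rfl

end Representation

section Ell1

variable {F : Type*} [NormedAddCommGroup F] [NormedSpace ℂ F]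

lemma hasSum_norm_ell1 (e : ell1) : HasSum (fun n => ‖e n‖) ‖e‖ := by
  simpa using lp.hasSum_norm (p := 1) (by simp) e

/-- A complex sequence whose partial `ℓ₁` norms are bounded by `C` lies in the ball of radius `C`
of `ℓ₁`. -/
lemma exists_ell1_of_sum_norm_le {c : ℕ → ℂ} {C : ℝ}
    (hc : ∀ N, ∑ n ∈ Finset.range N, ‖c n‖ ≤ C) :
    ∃ e : ell1, (∀ n, e n = c n) ∧ ‖e‖ ≤ C := by
  have hs : Summable fun n => ‖c n‖ := summable_of_sum_range_le (fun n => norm_nonneg _) hc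
  let e : ell1 := ⟨c, memℓp_gen (by simpa using hs)⟩
  exact ⟨e, fun n => rfl, le_of_tendsto' (hasSum_norm_ell1 e).tendsto_sum_nat hc⟩

/-- Every bounded sequence in a Banach space is the image of the unit vectors under a bounded
operator on `ℓ₁`. -/
lemma exists_clm_ell1_single [CompleteSpace F] {y : ℕ → F} {M : ℝ} (hy : ∀ n, ‖y n‖ ≤ M) :
    ∃ S : ell1 →L[ℂ] F, ∀ n c, S (lp.single 1 n c) = c • y n := by
  have hb (e : ell1) (n : ℕ) : ‖e n • y n‖ ≤ M * ‖e n‖ := by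
    rw [norm_smul, mul_comm]
    gcongr
    exact hy n
  have hs (e : ell1) : Summable fun n => e n • y n :=
    .of_norm_bounded ((hasSum_norm_ell1 e).summable.mul_left M) (hb e)
  refine ⟨LinearMap.mkContinuous
    { toFun := fun e => ∑' n, e n • y n
      map_add' := fun e f => ?_
      map_smul' := fun c e => ?_ } M fun e => ?_, fun n c => ?_⟩
  · rw [← (hs e).tsum_add (hs f)]
    simp [add_smul]
  · rw [RingHom.id_apply, ← (hs e).tsum_const_smul c]
    simp [mul_smul]
  · exact tsum_of_norm_bounded ((hasSum_norm_ell1 e).mul_left M) (hb e)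
  · change ∑' k, lp.single (E := fun _ : ℕ => ℂ) 1 n c k • y k = c • y n
    rw [tsum_eq_single n fun k hk => by rw [lp.single_apply_ne _ _ _ hk, zero_smul],
      lp.single_apply_self]

end Ell1

/-- Operators from `L₁` of a probability measure on the line to `ℓ₁` are given by integration
against a bounded strongly measurable density. -/
lemma exists_density_ell1 {μ : Measure ℝ} [IsProbabilityMeasure μ] (R : Lp ℂ 1 μ →L[ℂ] ell1) :
    ∃ a : ℝ → ell1, StronglyMeasurable a ∧ (∀ t, ‖a t‖ ≤ ‖R‖) ∧
      ∀ f : Lp ℂ 1 μ, R f = ∫ t, (f : ℝ → ℂ) t • a t ∂μ := by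
  let ev (n : ℕ) : ell1 →L[ℂ] ℂ := lp.evalCLM ℂ (fun _ : ℕ => ℂ) 1 n
  choose g hgm hgi hg using fun n => exists_density_of_functional ((ev n).comp R)
  let v := Besicovitch.vitaliFamily μ
  have hbound : ∀ᵐ t ∂μ, ∀ N, ∑ n ∈ Finset.range N, ‖g n t‖ ≤ ‖R‖ := by
    filter_upwards [ae_all_iff.2 fun n => v.ae_tendsto_average (hgi n).locallyIntegrable]
      with t ht N
    refine le_of_tendsto (tendsto_finsetSum _ fun n _ => (ht n).norm) ?_
    filter_upwards [v.eventually_filterAt_measurableSet t] with s hs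
    let e : Lp ℂ 1 μ := indicatorConstLp 1 hs (measure_ne_top μ s) 1
    have he : ‖e‖ = μ.real s := by
      simp [e, norm_indicatorConstLp]
    calc ∑ n ∈ Finset.range N, ‖⨍ y in s, g n y ∂μ‖
        = (μ.real s)⁻¹ * ∑ n ∈ Finset.range N, ‖R e n‖ := by
          rw [Finset.mul_sum]
          refine Finset.sum_congr rfl fun n _ => ?_
          rw [setAverage_eq, ← hg n s hs, norm_smul, norm_inv, Real.norm_of_nonneg (by positivity)]
          rfl
      _ ≤ (μ.real s)⁻¹ * (‖R‖ * μ.real s) := by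
          gcongr
          rw [← he]
          exact ((hasSum_norm_ell1 (R e)).summable.sum_le_tsum _ fun _ _ => norm_nonneg _).trans
            ((hasSum_norm_ell1 (R e)).tsum_eq.trans_le (R.le_opNorm e))
      _ ≤ ‖R‖ := by
          rcases eq_or_ne (μ.real s) 0 with h0 | h0
          · simp [h0]
          · field_simp
            exact le_rfl
  obtain ⟨B, hBsub, hBm, hB0⟩ := exists_measurable_superset_of_null (ae_iff.1 hbound)
  have hsum (t : ℝ) (N : ℕ) : ∑ n ∈ Finset.range N, ‖Bᶜ.indicator (g n) t‖ ≤ ‖R‖ := by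
    by_cases ht : t ∈ B
    · simp [ht]
    · have : ¬ ¬ ∀ N, ∑ n ∈ Finset.range N, ‖g n t‖ ≤ ‖R‖ := fun h => ht (hBsub h)
      simpa [ht] using not_not.1 this N
  choose a ha hale using fun t => exists_ell1_of_sum_norm_le (hsum t)
  have ham : StronglyMeasurable a := stronglyMeasurable_ell1 fun n => by
    simp_rw [ha]
    exact (hgm n).indicator hBm.compl
  obtain ⟨T, hT⟩ := exists_clm_integral_smul (μ := μ) ham.aestronglyMeasurable
    (Eventually.of_forall hale)
  have hRT : R = T := by
    refine clm_ext_indicatorConstLp fun s hs => ?_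
    have hai : Integrable a μ :=
      .of_bound ham.aestronglyMeasurable ‖R‖ (Eventually.of_forall hale)
    have hTs : T (indicatorConstLp 1 hs (measure_ne_top μ s) 1) = ∫ t in s, a t ∂μ := by
      rw [hT, ← integral_indicator hs]
      refine integral_congr_ae ?_
      filter_upwards [indicatorConstLp_coeFn (p := 1) (hs := hs) (hμs := measure_ne_top μ s)
        (c := (1 : ℂ))] with t ht
      rw [ht]
      by_cases hts : t ∈ s <;> simp [hts]
    ext n
    change ((ev n).comp R) _ = ev n _
    rw [hg n s hs, hTs, ← (ev n).integral_comp_comm hai.integrableOn]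
    refine integral_congr_ae (ae_restrict_of_ae ?_)
    filter_upwards [measure_eq_zero_iff_ae_notMem.1 hB0] with t ht
    exact ((ha t n).trans (Set.indicator_of_mem (Set.mem_compl ht) _)).symm
  exact ⟨a, ham, hale, fun f => (DFunLike.congr_fun hRT f).trans (hT f)⟩

/-- A bounded strongly measurable function into a Banach space lifts to a bounded strongly
measurable function into `ℓ₁`, along a suitable bounded operator defined on `ℓ₁`. -/
lemma exists_lift_ell1 {α : Type*} [MeasurableSpace α] {E : Type*} [NormedAddCommGroup E]
    [NormedSpace ℂ E] [CompleteSpace E] {h : α → E} (hm : StronglyMeasurable h) {C : ℝ}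
    (hC : ∀ t, ‖h t‖ ≤ C) (hC0 : 0 < C) :
    ∃ (a : α → ell1) (S : ell1 →L[ℂ] E), StronglyMeasurable a ∧ (∀ t, ‖a t‖ ≤ 2) ∧
      ∀ t, S (a t) = h t := by
  let F := Submodule.span ℂ (Set.range h)
  have hFsep : TopologicalSpace.SeparableSpace F :=
    (hm.isSeparable_range.span (R := ℂ)).separableSpace
  have hF2 : SecondCountableTopology F := UniformSpace.secondCountable_of_separable F
  let _ : MeasurableSpace E := borel E
  have _ : BorelSpace E := ⟨rfl⟩
  let u : α → F := fun t => ⟨h t, Submodule.subset_span ⟨t, rfl⟩⟩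
  have hu : Measurable u := hm.measurable.subtype_mk
  let d : ℕ → F := TopologicalSpace.denseSeq F
  have hd (x : F) : ∃ k, ‖x - d k‖ < C / 2 := by
    obtain ⟨k, hk⟩ := (TopologicalSpace.denseRange_denseSeq F).exists_dist_lt x (half_pos hC0)
    exact ⟨k, by rwa [← dist_eq_norm]⟩
  classical
  let k : F → ℕ := fun x => Nat.find (hd x)
  have hk (x : F) : ‖x - d (k x)‖ < C / 2 := Nat.find_spec (hd x)
  have hkm : Measurable k := measurable_find hd fun j =>
    measurableSet_lt (measurable_id.sub_const (d j)).norm measurable_const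
  let φ : F → F := fun x => (2 : ℂ) • (x - d (k x))
  have hφm : Measurable φ :=
    (measurable_id.sub ((measurable_of_countable d).comp hkm)).const_smul (2 : ℂ)
  have hφ (x : F) : ‖φ x‖ ≤ C := by
    rw [norm_smul, Complex.norm_ofNat]
    linarith [hk x]
  have hiter (t : α) (n : ℕ) : ‖φ^[n] (u t)‖ ≤ C := by
    cases n with
    | zero => exact hC t
    | succ n => rw [Function.iterate_succ_apply']; exact hφ _
  let y : ℕ → E := fun j => if ‖d j‖ ≤ 2 * C then (d j : E) else 0
  have hy (j : ℕ) : ‖y j‖ ≤ 2 * C := by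
    dsimp only [y]
    split_ifs with hj
    · exact hj
    · simpa using hC0.le
  have hyd (t : α) (n : ℕ) : y (k (φ^[n] (u t))) = d (k (φ^[n] (u t))) := by
    refine if_pos ?_
    have h1 := norm_sub_norm_le (d (k (φ^[n] (u t)))) (φ^[n] (u t))
    rw [norm_sub_rev] at h1
    linarith [hk (φ^[n] (u t)), hiter t n]
  obtain ⟨S, hS⟩ := exists_clm_ell1_single hy
  let b : ℕ → α → ell1 := fun n t => lp.single 1 (k (φ^[n] (u t))) ((1 / 2 : ℂ) ^ n)
  have hb (t : α) (n : ℕ) : ‖b n t‖ ≤ (1 / 2 : ℝ) ^ n := by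
    simp [b, lp.norm_single]
  have hbs (t : α) : Summable fun n => b n t :=
    .of_norm_bounded summable_geometric_two (hb t)
  have htele (t : α) (N : ℕ) : S (∑ n ∈ Finset.range N, b n t) =
      h t - (1 / 2 : ℂ) ^ N • (φ^[N] (u t) : E) := by
    induction N with
    | zero => simp [u]
    | succ N ih =>
      rw [Finset.sum_range_succ, map_add, ih, hS, hyd, Function.iterate_succ_apply']
      simp only [φ, Submodule.coe_smul, Submodule.coe_sub, smul_smul, pow_succ]
      rw [mul_assoc, one_div_mul_cancel two_ne_zero, mul_one, smul_sub]
      abel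
  refine ⟨fun t => ∑' n, b n t, S, ?_, fun t => ?_, fun t => ?_⟩
  · refine stronglyMeasurable_of_tendsto (u := (atTop : Filter ℕ))
      (f := fun N t => ∑ n ∈ Finset.range N, b n t) (fun N => ?_) ?_
    · refine Finset.stronglyMeasurable_fun_sum _ fun n _ => ?_
      exact (StronglyMeasurable.of_discrete (f := fun j : ℕ =>
        (lp.single 1 j ((1 / 2 : ℂ) ^ n) : ell1))).comp_measurable
        (hkm.comp ((hφm.iterate n).comp hu))
    · rw [tendsto_pi_nhds]
      exact fun t => (hbs t).hasSum.tendsto_sum_nat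
  · exact tsum_of_norm_bounded hasSum_geometric_two (hb t)
  · refine tendsto_nhds_unique
      ((S.continuous.tendsto _).comp (hbs t).hasSum.tendsto_sum_nat) ?_
    have hz : Tendsto (fun N => (1 / 2 : ℂ) ^ N • (φ^[N] (u t) : E)) atTop (nhds 0) := by
      refine squeeze_zero_norm (a := fun N => (1 / 2 : ℝ) ^ N * C) (fun N => ?_) ?_
      · rw [norm_smul]
        refine mul_le_mul (by simp) (hiter t N) (norm_nonneg _) (by positivity)
      · simpa using (tendsto_pow_atTop_nhds_zero_of_lt_one (r := (1 / 2 : ℝ))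
          (by norm_num) (by norm_num)).mul_const C
    have := (tendsto_const_nhds (x := h t)).sub hz
    rw [sub_zero] at this
    exact this.congr fun N => (htele t N).symm

instance : IsProbabilityMeasure μ01 := ⟨by simp [μ01]⟩

/-- (Lewis–Stegall) An operator `T : L₁[0,1] → E` into a Banach space is representable if
and only if it factors boundedly through `ℓ₁`. -/
theorem lewis_stegall {E : Type*} [NormedAddCommGroup E] [NormedSpace ℂ E] [CompleteSpace E]
    (T : L1C →L[ℂ] E) :
    IsRepresentable T ↔
      ∃ (R : L1C →L[ℂ] ell1) (S : ell1 →L[ℂ] E), T = S.comp R := by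
  have hcomp (R : L1C →L[ℂ] ell1) (S : ell1 →L[ℂ] E) {a : ℝ → ell1} (ha : StronglyMeasurable a)
      {C : ℝ} (hC : ∀ t, ‖a t‖ ≤ C) (hR : ∀ f : L1C, R f = ∫ t, (f : ℝ → ℂ) t • a t ∂μ01)
      (f : L1C) : S (R f) = ∫ t, (f : ℝ → ℂ) t • S (a t) ∂μ01 := by
    have hint : Integrable (fun t => (f : ℝ → ℂ) t • a t) μ01 :=
      (L1.integrable_coeFn f).smul_bdd C ha.aestronglyMeasurable (Eventually.of_forall hC)
    rw [hR, ← S.integral_comp_comm hint]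
    simp_rw [map_smul]
  constructor
  · rintro ⟨h, hm, ⟨C, hC⟩, hT⟩
    obtain ⟨a, S, ha, ha2, hS⟩ := exists_lift_ell1 (h := (Set.Icc (0 : ℝ) 1).indicator h)
      (hm.indicator measurableSet_Icc) (C := max C 1) (fun t => by
        by_cases ht : t ∈ Set.Icc (0 : ℝ) 1
        · rw [Set.indicator_of_mem ht]
          exact (hC t ht).trans (le_max_left _ _)
        · rw [Set.indicator_of_notMem ht, norm_zero]
          exact zero_le_one.trans (le_max_right _ _))
      (zero_lt_one.trans_le (le_max_right _ _))
    obtain ⟨R, hR⟩ := exists_clm_integral_smul (μ := μ01) ha.aestronglyMeasurable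
      (Eventually.of_forall ha2)
    refine ⟨R, S, ContinuousLinearMap.ext fun f => ?_⟩
    rw [ContinuousLinearMap.comp_apply, hcomp R S ha ha2 hR, hT]
    refine integral_congr_ae ?_
    filter_upwards [ae_restrict_mem (μ := volume) measurableSet_Icc] with t ht
    rw [hS, Set.indicator_of_mem ht]
  · rintro ⟨R, S, rfl⟩
    obtain ⟨a, ha, hC, hR⟩ := exists_density_ell1 R
    exact ⟨fun t => S (a t), S.continuous.comp_stronglyMeasurable ha,
      ⟨‖S‖ * ‖R‖, fun t _ => S.le_opNorm_of_le (hC t)⟩, hcomp R S ha hC hR⟩
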